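/- Let T be the closed triangle in ℝ² with vertices (0,0), (1,0), (0,1). For every function v : ℝ² → ℝ twice continuously differentiable on a neighborhood of T and satisfying the three edge conditions ∫₀¹ v(t,0) dt = 0, ∫₀¹ v(0,t) dt = 0 and ∫₀¹ v(t,1−t) dt = 0, one has ∫_T v² dx ≤ (0.24647/π)² · ∫_T ((∂²v/∂x₁²)² + 2(∂²v/∂x₁∂x₂)² + (∂²v/∂x₂²)²) dx. -/

import Mathlib

open MeasureTheory Set

/-- Lower bound for the integral of the squared derivative, obtained by completing the square with
a solution `p` of a Riccati equation. -/
theorem le_integral_sq_deriv_of_riccati {a b c : ℝ} (hab : a ≤ b) {f f' p p' : ℝ → ℝ}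
    (hf : ∀ x ∈ Icc a b, HasDerivAt f (f' x) x) (hf' : IntervalIntegrable f' volume a b)
    (hf'2 : IntervalIntegrable (fun x => f' x ^ 2) volume a b)
    (hp : ∀ x ∈ Icc a b, HasDerivAt p (p' x) x) (hp' : ∀ x ∈ Icc a b, p' x = p x ^ 2 + c) :
    c * ∫ x in a..b, f x ^ 2 ≤ (∫ x in a..b, f' x ^ 2) + p b * f b ^ 2 - p a * f a ^ 2 := by
  have cf : ContinuousOn f (Icc a b) := fun x hx => (hf x hx).continuousAt.continuousWithinAt
  have cp : ContinuousOn p (Icc a b) := fun x hx => (hp x hx).continuousAt.continuousWithinAt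
  have i2 : IntervalIntegrable (fun x => (p x ^ 2 + c) * f x ^ 2 + p x * (2 * f x * f' x))
      volume a b := by
    have h : IntervalIntegrable (fun x => (2 * p x * f x) * f' x) volume a b :=
      hf'.continuousOn_mul (by rw [uIcc_of_le hab]; fun_prop)
    have h' : IntervalIntegrable (fun x => (p x ^ 2 + c) * f x ^ 2) volume a b :=
      ContinuousOn.intervalIntegrable_of_Icc hab (by fun_prop)
    refine h'.add (h.congr fun x _ => ?_)
    ring
  have key : ∫ x in a..b, ((p x ^ 2 + c) * f x ^ 2 + p x * (2 * f x * f' x))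
      = p b * f b ^ 2 - p a * f a ^ 2 := by
    refine intervalIntegral.integral_eq_sub_of_hasDerivAt (f := fun x => p x * f x ^ 2)
      (fun x hx => ?_) ?_
    · rw [uIcc_of_le hab] at hx
      have := (hp x hx).mul ((hf x hx).pow 2)
      rw [hp' x hx] at this
      exact this.congr_deriv (by simp)
    · exact i2
  have sq : 0 ≤ ∫ x in a..b, (f' x + p x * f x) ^ 2 :=
    intervalIntegral.integral_nonneg hab fun x _ => sq_nonneg _
  have i3 : IntervalIntegrable (fun x => c * f x ^ 2) volume a b :=
    ContinuousOn.intervalIntegrable_of_Icc hab (by fun_prop)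
  have e : ∫ x in a..b, (f' x + p x * f x) ^ 2 =
      (∫ x in a..b, f' x ^ 2) +
        (∫ x in a..b, ((p x ^ 2 + c) * f x ^ 2 + p x * (2 * f x * f' x)))
        - ∫ x in a..b, c * f x ^ 2 := by
    rw [← intervalIntegral.integral_add hf'2 i2, ← intervalIntegral.integral_sub (hf'2.add i2) i3]
    congr 1; ext x; ring
  rw [intervalIntegral.integral_const_mul] at e
  linarith

theorem hasDerivAt_mul_tan {k d x : ℝ} (h : k * x + d ∈ Ioo (-(Real.pi / 2)) (Real.pi / 2)) :
    HasDerivAt (fun x => k * Real.tan (k * x + d)) ((k * Real.tan (k * x + d)) ^ 2 + k ^ 2) x := by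
  have hc : Real.cos (k * x + d) ≠ 0 := (Real.cos_pos_of_mem_Ioo h).ne'
  have h1 : HasDerivAt (fun x => k * x + d) k x := by
    simpa using ((hasDerivAt_id x).const_mul k).add_const d
  have := ((Real.hasDerivAt_tan hc).comp x h1).const_mul k
  refine this.congr_deriv ?_
  rw [Real.tan_eq_sin_div_cos]
  have := Real.sin_sq_add_cos_sq (k * x + d)
  field_simp
  nlinarith

/-- The Dirichlet Poincaré inequality on an interval. -/
theorem poincare_dirichlet {l : ℝ} (hl : 0 < l) {f f' : ℝ → ℝ}
    (hf : ∀ x ∈ Icc 0 l, HasDerivAt f (f' x) x) (hf' : IntervalIntegrable f' volume 0 l)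
    (hf'2 : IntervalIntegrable (fun x => f' x ^ 2) volume 0 l)
    (h0 : f 0 = 0) (h1 : f l = 0) :
    (Real.pi / l) ^ 2 * ∫ x in 0..l, f x ^ 2 ≤ ∫ x in 0..l, f' x ^ 2 := by
  have main : ∀ k ∈ Ioo 0 (Real.pi / l),
      k ^ 2 * ∫ x in 0..l, f x ^ 2 ≤ ∫ x in 0..l, f' x ^ 2 := by
    rintro k ⟨hk0, hk⟩
    have hkl : k * l < Real.pi := (lt_div_iff₀ hl).1 hk
    have := le_integral_sq_deriv_of_riccati (c := k ^ 2) hl.le hf hf' hf'2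
      (p := fun x => k * Real.tan (k * x + -(k * l / 2)))
      (fun x hx => hasDerivAt_mul_tan (by
        have h2 := mul_le_mul_of_nonneg_left hx.2 hk0.le
        have h3 := mul_nonneg hk0.le hx.1
        constructor <;> linarith)) (fun x _ => rfl)
    simpa [h0, h1] using this
  have hpl : 0 < Real.pi / l := div_pos Real.pi_pos hl
  refine ContinuousWithinAt.closure_le (s := Ioo 0 (Real.pi / l)) (x := Real.pi / l)
    (f := fun k : ℝ => k ^ 2 * ∫ x in 0..l, f x ^ 2) (g := fun _ => ∫ x in 0..l, f' x ^ 2)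
    ?_ (by fun_prop) (by fun_prop) main
  rw [closure_Ioo hpl.ne]
  exact right_mem_Icc.2 hpl.le

theorem integrable_of_measurable_of_bounded {α : Type*} [MeasurableSpace α] {μ : Measure α}
    [IsFiniteMeasure μ] {g : α → ℝ} (hg : Measurable g) (hb : ∃ C, ∀ x, |g x| ≤ C) :
    Integrable g μ := by
  obtain ⟨C, hC⟩ := hb
  exact Integrable.of_bound hg.aestronglyMeasurable C (.of_forall hC)

theorem intervalIntegrable_of_measurable_of_bounded {g : ℝ → ℝ} (hg : Measurable g)
    (hb : ∃ C, ∀ x, |g x| ≤ C) (a b : ℝ) : IntervalIntegrable g volume a b := by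
  rw [intervalIntegrable_iff]
  have : IsFiniteMeasure (volume.restrict (uIoc a b)) := ⟨by simp⟩
  exact integrable_of_measurable_of_bounded hg hb

theorem exists_abs_sq_le {α : Type*} {g : α → ℝ} (hb : ∃ C, ∀ x, |g x| ≤ C) :
    ∃ C, ∀ x, |g x ^ 2| ≤ C := by
  obtain ⟨C, hC⟩ := hb
  refine ⟨C ^ 2, fun x => ?_⟩
  rw [abs_pow]
  exact pow_le_pow_left₀ (abs_nonneg _) (hC x) 2

/-- The Poincaré–Wirtinger inequality on the unit interval, for functions with finitely or
countably many kinks. -/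
theorem poincare_wirtinger {f g : ℝ → ℝ} {s : Set ℝ} (hs : s.Countable) (hf : Continuous f)
    (hfg : ∀ x ∉ s, HasDerivAt f (g x) x) (hg : Measurable g) (hb : ∃ C, ∀ x, |g x| ≤ C) :
    Real.pi ^ 2 * ((∫ x in (0 : ℝ)..1, f x ^ 2) - (∫ x in (0 : ℝ)..1, f x) ^ 2)
      ≤ ∫ x in (0 : ℝ)..1, g x ^ 2 := by
  set m := ∫ x in (0 : ℝ)..1, f x with hm
  set F : ℝ → ℝ := fun x => ∫ t in (0 : ℝ)..x, (f t - m) with hF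
  have cF' : Continuous fun t => f t - m := by fun_prop
  have dF : ∀ x, HasDerivAt F (f x - m) x := fun x =>
    cF'.integral_hasStrictDerivAt 0 x |>.hasDerivAt
  have cF : Continuous F := continuous_iff_continuousAt.2 fun x => (dF x).continuousAt
  have F0 : F 0 = 0 := by simp [hF]
  have F1 : F 1 = 0 := by
    simp only [hF]
    rw [intervalIntegral.integral_sub (hf.intervalIntegrable _ _) (by simp)]
    simp [hm]
  have ig := intervalIntegrable_of_measurable_of_bounded hg hb 0 1
  have ig2 := intervalIntegrable_of_measurable_of_bounded (hg.pow_const 2) (exists_abs_sq_le hb) 0 1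
  have iFg : IntervalIntegrable (fun x => F x * g x) volume 0 1 :=
    ig.continuousOn_mul cF.continuousOn
  have iF2 : IntervalIntegrable (fun x => F x ^ 2) volume 0 1 :=
    (cF.pow 2).intervalIntegrable _ _
  have if2 : IntervalIntegrable (fun x => (f x - m) ^ 2) volume 0 1 :=
    (cF'.pow 2).intervalIntegrable _ _
  have parts : ∫ x in (0 : ℝ)..1, ((f x - m) ^ 2 + F x * g x) = 0 := by
    rw [MeasureTheory.integral_eq_of_hasDerivAt_off_countable (f := fun x => F x * (f x - m)) _ hs
      (by fun_prop) (fun x hx => ?_) (if2.add iFg)]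
    · simp [F0, F1]
    · exact ((dF x).mul ((hfg x hx.2).sub_const m)).congr_deriv (by ring)
  rw [intervalIntegral.integral_add if2 iFg] at parts
  have dir := poincare_dirichlet one_pos (fun x _ => dF x) (cF'.intervalIntegrable _ _)
    if2 F0 F1
  have sq : 0 ≤ ∫ x in (0 : ℝ)..1, (g x + Real.pi ^ 2 * F x) ^ 2 :=
    intervalIntegral.integral_nonneg zero_le_one fun x _ => sq_nonneg _
  have e : ∫ x in (0 : ℝ)..1, (g x + Real.pi ^ 2 * F x) ^ 2 = (∫ x in (0 : ℝ)..1, g x ^ 2)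
      + 2 * Real.pi ^ 2 * (∫ x in (0 : ℝ)..1, F x * g x)
      + Real.pi ^ 4 * ∫ x in (0 : ℝ)..1, F x ^ 2 := by
    rw [← intervalIntegral.integral_const_mul, ← intervalIntegral.integral_const_mul,
      ← intervalIntegral.integral_add ig2 (iFg.const_mul _),
      ← intervalIntegral.integral_add (ig2.add (iFg.const_mul _)) (iF2.const_mul _)]
    congr 1; ext x; ring
  have var : ∫ x in (0 : ℝ)..1, (f x - m) ^ 2 = (∫ x in (0 : ℝ)..1, f x ^ 2) - m ^ 2 := by
    have : ∫ x in (0 : ℝ)..1, (f x - m) ^ 2 =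
        ∫ x in (0 : ℝ)..1, (f x ^ 2 - 2 * m * f x + m ^ 2) := by
      congr 1; ext x; ring
    rw [this, intervalIntegral.integral_add (by apply Continuous.intervalIntegrable; fun_prop)
      (by simp), intervalIntegral.integral_sub (by apply Continuous.intervalIntegrable; fun_prop)
      (by apply Continuous.intervalIntegrable; fun_prop), intervalIntegral.integral_const_mul,
      ← hm]
    simp; ring
  rw [div_one] at dir
  rw [var] at parts dir
  nlinarith [sq_nonneg Real.pi]

theorem le_arctan {x : ℝ} (hx : 0 ≤ x) :
    x - x ^ 3 / 3 + x ^ 5 / 5 - x ^ 7 / 7 + x ^ 9 / 9 - x ^ 11 / 11 ≤ Real.arctan x := by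
  have hd : ∀ y : ℝ, HasDerivAt (fun x : ℝ => Real.arctan x -
      (x - x ^ 3 / 3 + x ^ 5 / 5 - x ^ 7 / 7 + x ^ 9 / 9 - x ^ 11 / 11))
      (y ^ 12 / (1 + y ^ 2)) y := by
    intro y
    have h := (Real.hasDerivAt_arctan y).sub
      ((((((hasDerivAt_id y).sub ((hasDerivAt_pow 3 y).div_const 3)).add
      ((hasDerivAt_pow 5 y).div_const 5)).sub ((hasDerivAt_pow 7 y).div_const 7)).add
      ((hasDerivAt_pow 9 y).div_const 9)).sub ((hasDerivAt_pow 11 y).div_const 11))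
    refine h.congr_deriv ?_
    have : 1 + y ^ 2 ≠ 0 := by positivity
    field_simp
    ring
  have hm := monotone_of_deriv_nonneg (fun y => (hd y).differentiableAt)
    (fun y => by rw [(hd y).deriv]; positivity)
  have := hm hx
  simp at this
  linarith

theorem sub_arctan_lt_pi_div_two : 1 / 0.24647 / 2 - Real.arctan 0.49294 < Real.pi / 2 := by
  have h := le_arctan (x := 0.49294) (by norm_num)
  have := Real.pi_gt_d6
  norm_num at h ⊢
  linarith

/-- The primitive `G` of `M - e`, where `M` is the integral of `e`, satisfies a Poincaré inequality
with a Robin condition at `0`, whose eigenvalue is estimated by `sub_arctan_lt_pi_div_two`. -/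
theorem sq_deriv_bound_of_zero_left {e g : ℝ → ℝ} (he : ∀ x, HasDerivAt e (g x) x)
    (hg : Measurable g) (hb : ∃ C, ∀ x, |g x| ≤ C) (h0 : e 0 = 0) :
    (1 / 0.24647) ^ 2 * ((∫ x in (0 : ℝ)..(1 / 2), e x ^ 2) - (∫ x in (0 : ℝ)..(1 / 2), e x) ^ 2)
      ≤ ∫ x in (0 : ℝ)..(1 / 2), g x ^ 2 := by
  have he' : Continuous e := continuous_iff_continuousAt.2 fun x => (he x).continuousAt
  set M := ∫ x in (0 : ℝ)..(1 / 2), e x with hM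
  set G : ℝ → ℝ := fun x => (∫ t in (0 : ℝ)..x, (M - e t)) + M / 2 with hG
  have cG' : Continuous fun t => M - e t := by fun_prop
  have dG : ∀ x, HasDerivAt G (M - e x) x := fun x =>
    (cG'.integral_hasStrictDerivAt 0 x |>.hasDerivAt).add_const _
  have cG : Continuous G := continuous_iff_continuousAt.2 fun x => (dG x).continuousAt
  have G0 : G 0 = M / 2 := by simp [hG]
  have G1 : G (1 / 2) = 0 := by
    simp only [hG]
    rw [intervalIntegral.integral_sub (by simp) (he'.intervalIntegrable _ _), ← hM]
    simp; ring
  have ig := intervalIntegrable_of_measurable_of_bounded hg hb 0 (1 / 2)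
  have ig2 := intervalIntegrable_of_measurable_of_bounded (hg.pow_const 2)
    (exists_abs_sq_le hb) 0 (1 / 2)
  have iGg : IntervalIntegrable (fun x => G x * g x) volume 0 (1 / 2) :=
    ig.continuousOn_mul cG.continuousOn
  have iG2 : IntervalIntegrable (fun x => G x ^ 2) volume 0 (1 / 2) :=
    (cG.pow 2).intervalIntegrable _ _
  have ie2 : IntervalIntegrable (fun x => (M - e x) ^ 2) volume 0 (1 / 2) :=
    (cG'.pow 2).intervalIntegrable _ _
  have parts : ∫ x in (0 : ℝ)..(1 / 2), ((M - e x) ^ 2 - G x * g x) = - (M ^ 2 / 2) := by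
    rw [intervalIntegral.integral_eq_sub_of_hasDerivAt (f := fun x => G x * (M - e x))
      (fun x _ => ?_) (ie2.sub iGg)]
    · simp only [G0, G1, h0]; ring
    · exact ((dG x).mul ((he x).const_sub M)).congr_deriv (by ring)
  rw [intervalIntegral.integral_sub ie2 iGg] at parts
  have ric := le_integral_sq_deriv_of_riccati (c := (1 / 0.24647) ^ 2) (by norm_num)
    (fun x _ => dG x) (cG'.intervalIntegrable _ _) ie2
    (p := fun x => 1 / 0.24647 * Real.tan (1 / 0.24647 * x + -Real.arctan 0.49294))
    (fun x hx => hasDerivAt_mul_tan (by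
      have h1 := sub_arctan_lt_pi_div_two
      have h2 := Real.arctan_lt_pi_div_two 0.49294
      obtain ⟨h3, h4⟩ := hx
      constructor
      · have : 0 ≤ 1 / 0.24647 * x := by positivity
        linarith
      · have : 1 / 0.24647 * x ≤ 1 / 0.24647 * (1 / 2) := by gcongr
        linarith)) (fun x _ => rfl)
  have sq : 0 ≤ ∫ x in (0 : ℝ)..(1 / 2), (g x - (1 / 0.24647) ^ 2 * G x) ^ 2 :=
    intervalIntegral.integral_nonneg (by norm_num) fun x _ => sq_nonneg _
  have e1 : ∫ x in (0 : ℝ)..(1 / 2), (g x - (1 / 0.24647) ^ 2 * G x) ^ 2 =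
      (∫ x in (0 : ℝ)..(1 / 2), g x ^ 2)
      - 2 * (1 / 0.24647) ^ 2 * (∫ x in (0 : ℝ)..(1 / 2), G x * g x)
      + (1 / 0.24647) ^ 4 * ∫ x in (0 : ℝ)..(1 / 2), G x ^ 2 := by
    rw [← intervalIntegral.integral_const_mul, ← intervalIntegral.integral_const_mul,
      ← intervalIntegral.integral_sub ig2 (iGg.const_mul _),
      ← intervalIntegral.integral_add (ig2.sub (iGg.const_mul _)) (iG2.const_mul _)]
    congr 1; ext x; ring
  have var : ∫ x in (0 : ℝ)..(1 / 2), (M - e x) ^ 2 =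
      (∫ x in (0 : ℝ)..(1 / 2), e x ^ 2) - 3 / 2 * M ^ 2 := by
    have : ∫ x in (0 : ℝ)..(1 / 2), (M - e x) ^ 2 =
        ∫ x in (0 : ℝ)..(1 / 2), (e x ^ 2 - 2 * M * e x + M ^ 2) := by
      congr 1; ext x; ring
    rw [this, intervalIntegral.integral_add (by apply Continuous.intervalIntegrable; fun_prop)
      (by simp), intervalIntegral.integral_sub (by apply Continuous.intervalIntegrable; fun_prop)
      (by apply Continuous.intervalIntegrable; fun_prop), intervalIntegral.integral_const_mul,
      ← hM]
    simp; ring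
  rw [var] at parts ric
  simp only [mul_zero, zero_add, Real.tan_neg, Real.tan_arctan, G0, G1] at ric
  norm_num at ric sq e1 ⊢
  nlinarith

theorem integral_eq_half_add_reflect {f : ℝ → ℝ} (hf : ∀ a b, IntervalIntegrable f volume a b) :
    ∫ x in (0 : ℝ)..1, f x = ∫ x in (0 : ℝ)..(1 / 2), (f x + f (1 - x)) := by
  have h : IntervalIntegrable (fun x => f (1 - x)) volume 0 (1 / 2) := by
    convert (hf 1 (1 / 2)).comp_sub_left 1 using 1 <;> norm_num
  rw [intervalIntegral.integral_add (hf _ _) h, intervalIntegral.integral_comp_sub_left (f := f),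
    ← intervalIntegral.integral_add_adjacent_intervals (hf 0 (1 / 2)) (hf (1 / 2) 1)]
  norm_num

/-- Splitting into even and odd parts about `1 / 2` reduces the case of two vanishing endpoint
values to the half interval. -/
theorem sq_deriv_bound_of_zero_endpoints {a g : ℝ → ℝ} (ha : ∀ x, HasDerivAt a (g x) x)
    (hg : Measurable g) (hb : ∃ C, ∀ x, |g x| ≤ C) (h0 : a 0 = 0) (h1 : a 1 = 0) :
    (1 / 0.24647) ^ 2 * ((∫ x in (0 : ℝ)..1, a x ^ 2) - (∫ x in (0 : ℝ)..1, a x) ^ 2 / 2)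
      ≤ ∫ x in (0 : ℝ)..1, g x ^ 2 := by
  have ca : Continuous a := continuous_iff_continuousAt.2 fun x => (ha x).continuousAt
  have hr : ∀ x, HasDerivAt (fun x => a (1 - x)) (-g (1 - x)) x := fun x => by
    simpa using (ha (1 - x)).comp_const_sub 1 x
  set e : ℝ → ℝ := fun x => (a x + a (1 - x)) / 2 with he
  set o : ℝ → ℝ := fun x => (a x - a (1 - x)) / 2 with ho
  set e' : ℝ → ℝ := fun x => (g x + -g (1 - x)) / 2 with he'
  set o' : ℝ → ℝ := fun x => (g x - -g (1 - x)) / 2 with ho'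
  have de : ∀ x, HasDerivAt e (e' x) x := fun x => ((ha x).add (hr x)).div_const 2
  have dO : ∀ x, HasDerivAt o (o' x) x := fun x => ((ha x).sub (hr x)).div_const 2
  have ce : Continuous e := continuous_iff_continuousAt.2 fun x => (de x).continuousAt
  have co : Continuous o := continuous_iff_continuousAt.2 fun x => (dO x).continuousAt
  have me : Measurable e' := by fun_prop
  have mo : Measurable o' := by fun_prop
  obtain ⟨C, hC⟩ := hb
  have be : ∃ C, ∀ x, |e' x| ≤ C := ⟨C, fun x => by
    have := abs_le.1 (hC x); have := abs_le.1 (hC (1 - x))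
    exact abs_le.2 ⟨by simp only [he']; linarith, by simp only [he']; linarith⟩⟩
  have bo : ∃ C, ∀ x, |o' x| ≤ C := ⟨C, fun x => by
    have := abs_le.1 (hC x); have := abs_le.1 (hC (1 - x))
    exact abs_le.2 ⟨by simp only [ho']; linarith, by simp only [ho']; linarith⟩⟩
  have ie2 := intervalIntegrable_of_measurable_of_bounded (me.pow_const 2)
    (exists_abs_sq_le be) 0 (1 / 2)
  have io2 := intervalIntegrable_of_measurable_of_bounded (mo.pow_const 2)
    (exists_abs_sq_le bo) 0 (1 / 2)
  have hE := sq_deriv_bound_of_zero_left de me be (by simp [he, h0, h1])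
  have hO := poincare_dirichlet (l := 1 / 2) (by norm_num) (fun x _ => dO x)
    (intervalIntegrable_of_measurable_of_bounded mo bo _ _) io2
    (by simp [ho, h0, h1]) (by simp only [ho]; norm_num)
  have s1 : ∫ x in (0 : ℝ)..1, a x ^ 2 =
      2 * (∫ x in (0 : ℝ)..(1 / 2), e x ^ 2) + 2 * ∫ x in (0 : ℝ)..(1 / 2), o x ^ 2 := by
    rw [integral_eq_half_add_reflect (f := fun x => a x ^ 2)
        fun _ _ => (ca.pow 2).intervalIntegrable _ _,
      ← intervalIntegral.integral_const_mul, ← intervalIntegral.integral_const_mul,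
      ← intervalIntegral.integral_add (by apply Continuous.intervalIntegrable; fun_prop)
        (by apply Continuous.intervalIntegrable; fun_prop)]
    congr 1; ext x; simp only [he, ho]; ring
  have s2 : ∫ x in (0 : ℝ)..1, a x = 2 * ∫ x in (0 : ℝ)..(1 / 2), e x := by
    rw [integral_eq_half_add_reflect fun _ _ => ca.intervalIntegrable _ _,
      ← intervalIntegral.integral_const_mul]
    congr 1; ext x; simp only [he]; ring
  have s3 : ∫ x in (0 : ℝ)..1, g x ^ 2 =
      2 * (∫ x in (0 : ℝ)..(1 / 2), e' x ^ 2) + 2 * ∫ x in (0 : ℝ)..(1 / 2), o' x ^ 2 := by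
    rw [integral_eq_half_add_reflect fun _ _ => intervalIntegrable_of_measurable_of_bounded
        (hg.pow_const 2) (exists_abs_sq_le ⟨C, hC⟩) _ _,
      ← intervalIntegral.integral_const_mul, ← intervalIntegral.integral_const_mul,
      ← intervalIntegral.integral_add (ie2.const_mul _) (io2.const_mul _)]
    congr 1; ext x; simp only [he', ho']; ring
  have hpos : 0 ≤ ∫ x in (0 : ℝ)..(1 / 2), o x ^ 2 :=
    intervalIntegral.integral_nonneg (by norm_num) fun x _ => sq_nonneg _
  have hpi : (1 / 0.24647) ^ 2 ≤ (Real.pi / (1 / 2)) ^ 2 := by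
    have := Real.pi_gt_three
    refine pow_le_pow_left₀ (by norm_num) ?_ 2
    norm_num
    linarith
  have := mul_le_mul_of_nonneg_right hpi hpos
  rw [s1, s2, s3]
  linarith

theorem abs_sub_le_of_hasDerivAt_off_countable {f g : ℝ → ℝ} {s : Set ℝ} (hs : s.Countable)
    (hf : Continuous f) (hfg : ∀ x ∉ s, HasDerivAt f (g x) x) (hg : Measurable g) {C : ℝ}
    (hC : ∀ x, |g x| ≤ C) (x y : ℝ) : |f y - f x| ≤ C * |y - x| := by
  rw [← MeasureTheory.integral_eq_of_hasDerivAt_off_countable f g hs hf.continuousOn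
    (fun t ht => hfg t ht.2) (intervalIntegrable_of_measurable_of_bounded hg ⟨C, hC⟩ x y)]
  exact intervalIntegral.norm_integral_le_of_norm_le_const (f := g) fun t _ => hC t

theorem hasDerivAt_integral_of_kinks {w D : ℝ × ℝ → ℝ} (hw : Continuous w) (hD : Measurable D)
    (hDb : ∃ C, ∀ p, |D p| ≤ C)
    (hwD : ∀ x y, x + y ≠ 1 → HasDerivAt (fun t => w (x, t)) (D (x, y)) y) (y : ℝ) :
    HasDerivAt (fun y => ∫ x in (0 : ℝ)..1, w (x, y)) (∫ x in (0 : ℝ)..1, D (x, y)) y := by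
  obtain ⟨C, hC⟩ := hDb
  have hC0 : 0 ≤ C := (abs_nonneg _).trans (hC 0)
  refine (intervalIntegral.hasDerivAt_integral_of_dominated_loc_of_lip (F := fun y x => w (x, y))
    (bound := fun _ => C) Filter.univ_mem ?_ ?_ ?_ ?_ (by simp) ?_).2
  · exact .of_forall fun y => Continuous.aestronglyMeasurable (by fun_prop)
  · exact Continuous.intervalIntegrable (by fun_prop) _ _
  · exact Measurable.aestronglyMeasurable (by fun_prop)
  · refine .of_forall fun x _ => LipschitzOnWith.of_dist_le_mul fun t _ s _ => ?_
    have := abs_sub_le_of_hasDerivAt_off_countable (countable_singleton (1 - x))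
      (f := fun t => w (x, t)) (g := fun t => D (x, t)) (by fun_prop)
      (fun t ht => hwD x t fun h => ht (by simp; linarith)) (by fun_prop) (fun t => hC _) s t
    simpa [Real.dist_eq, abs_of_nonneg hC0] using this
  · have : ∀ᵐ x : ℝ, x ≠ 1 - y := by simp [ae_iff]
    filter_upwards [this] with x hx _
    exact hwD x y fun h => hx (by linarith)

theorem integral_sub_const_mul_add {α : Type*} [MeasurableSpace α] {μ : Measure α}
    {f g h : α → ℝ} (hf : Integrable f μ) (hg : Integrable g μ) (hh : Integrable h μ) (c : ℝ) :
    ∫ x, (f x - c * g x + h x) ∂μ = (∫ x, f x ∂μ) - c * (∫ x, g x ∂μ) + ∫ x, h x ∂μ := by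
  have hfg : Integrable (fun x => f x - c * g x) μ := hf.sub (hg.const_mul c)
  rw [integral_add hfg hh, integral_sub hf (hg.const_mul c), integral_const_mul]

theorem integral_sub_const_sq {α : Type*} [MeasurableSpace α] {μ : Measure α}
    [IsProbabilityMeasure μ] {f : α → ℝ} (hf : Integrable f μ)
    (hf2 : Integrable (fun x => f x ^ 2) μ) (c : ℝ) :
    ∫ x, (f x - c) ^ 2 ∂μ = (∫ x, f x ^ 2 ∂μ) - 2 * c * (∫ x, f x ∂μ) + c ^ 2 := by
  have := integral_sub_const_mul_add hf2 hf (integrable_const (c ^ 2)) (2 * c)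
  simp only [integral_const, probReal_univ, one_smul] at this
  rw [← this]
  congr 1; ext x; ring

theorem integral_sub_marginal_sq {ν : Measure ℝ} [IsProbabilityMeasure ν] {H : ℝ × ℝ → ℝ}
    (hH : Measurable H) (hb : ∃ C, ∀ p, |H p| ≤ C) :
    ∫ p, (H p - ∫ x, H (x, p.2) ∂ν) ^ 2 ∂(ν.prod ν) =
      (∫ p, H p ^ 2 ∂(ν.prod ν)) - ∫ y, (∫ x, H (x, y) ∂ν) ^ 2 ∂ν := by
  set h : ℝ → ℝ := fun y => ∫ x, H (x, y) ∂ν with hh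
  have mh : Measurable h :=
    (hH.stronglyMeasurable.integral_prod_left' (μ := ν)).measurable
  obtain ⟨C, hC⟩ := hb
  have hC0 : 0 ≤ C := (abs_nonneg _).trans (hC 0)
  have hhb : ∀ y, |h y| ≤ C := fun y => by
    simpa using norm_integral_le_of_norm_le_const (μ := ν) (f := fun x => H (x, y))
      (.of_forall fun x => hC (x, y))
  have i1 : Integrable (fun p => H p ^ 2) (ν.prod ν) :=
    integrable_of_measurable_of_bounded (by fun_prop) (exists_abs_sq_le ⟨C, hC⟩)
  have i2 : Integrable (fun p : ℝ × ℝ => H p * h p.2) (ν.prod ν) :=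
    integrable_of_measurable_of_bounded (by fun_prop) ⟨C * C, fun p => by
      rw [abs_mul]; exact mul_le_mul (hC p) (hhb _) (abs_nonneg _) hC0⟩
  have i3 : Integrable (fun p : ℝ × ℝ => h p.2 ^ 2) (ν.prod ν) :=
    integrable_of_measurable_of_bounded (by fun_prop) (exists_abs_sq_le ⟨C, fun p => hhb p.2⟩)
  have e2 : ∫ p, H p * h p.2 ∂(ν.prod ν) = ∫ y, h y ^ 2 ∂ν := by
    rw [integral_prod_symm _ i2]
    congr 1; ext y
    simp only [integral_mul_const]
    rw [sq]
  have e3 : ∫ p, h p.2 ^ 2 ∂(ν.prod ν) = ∫ y, h y ^ 2 ∂ν := by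
    rw [integral_prod_symm _ i3]
    simp
  have e : ∫ p, (H p - h p.2) ^ 2 ∂(ν.prod ν) =
      ∫ p, (H p ^ 2 - 2 * (H p * h p.2) + h p.2 ^ 2) ∂(ν.prod ν) := by
    congr 1; ext p; ring
  rw [e, integral_sub_const_mul_add i1 i2 i3, e2, e3]
  ring

/-- The Poincaré inequality in the second variable on the unit square for the part of `w` with
vanishing marginals, together with the nonnegativity of the norm of that part. -/
theorem poincare_square {ν : Measure ℝ} (hν : ν = volume.restrict (Ioc 0 1)) {w D : ℝ × ℝ → ℝ}
    (hw : Continuous w) (hwb : ∃ C, ∀ p, |w p| ≤ C) (hD : Measurable D)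
    (hDb : ∃ C, ∀ p, |D p| ≤ C)
    (hwD : ∀ x y, x + y ≠ 1 → HasDerivAt (fun t => w (x, t)) (D (x, y)) y) :
    let N := (∫ p, w p ^ 2 ∂(ν.prod ν)) - (∫ y, (∫ x, w (x, y) ∂ν) ^ 2 ∂ν)
      - (∫ x, (∫ y, w (x, y) ∂ν) ^ 2 ∂ν) + (∫ p, w p ∂(ν.prod ν)) ^ 2
    0 ≤ N ∧ Real.pi ^ 2 * N ≤
      (∫ p, D p ^ 2 ∂(ν.prod ν)) - ∫ y, (∫ x, D (x, y) ∂ν) ^ 2 ∂ν := by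
  have : IsProbabilityMeasure ν := ⟨by simp [hν]⟩
  have hI : ∀ f : ℝ → ℝ, ∫ x, f x ∂ν = ∫ x in (0 : ℝ)..1, f x := fun f => by
    rw [hν, intervalIntegral.integral_of_le zero_le_one]
  set b : ℝ → ℝ := fun y => ∫ x, w (x, y) ∂ν with hbdef
  set β : ℝ → ℝ := fun y => ∫ x, D (x, y) ∂ν with hβdef
  set a : ℝ → ℝ := fun x => ∫ y, w (x, y) ∂ν with hadef
  set m := ∫ p, w p ∂(ν.prod ν) with hm
  intro N
  have hb : ∀ y, HasDerivAt b (β y) y := fun y => by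
    simp only [hbdef, hβdef, hI]
    exact hasDerivAt_integral_of_kinks hw hD hDb hwD y
  have cb : Continuous b := continuous_iff_continuousAt.2 fun x => (hb x).continuousAt
  have mβ : Measurable β :=
    (hD.stronglyMeasurable.integral_prod_left' (μ := ν)).measurable
  have ma : Measurable a :=
    (hw.measurable.stronglyMeasurable.integral_prod_right' (ν := ν)).measurable
  have iw : Integrable w (ν.prod ν) := integrable_of_measurable_of_bounded hw.measurable hwb
  have hmb : ∫ y, b y ∂ν = m := (integral_prod_symm w iw).symm
  have hma : ∫ x, a x ∂ν = m := (integral_prod w iw).symm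
  obtain ⟨C, hC⟩ := hwb
  obtain ⟨C', hC'⟩ := hDb
  have bb : ∀ y, |b y| ≤ C := fun y => by
    simpa using norm_integral_le_of_norm_le_const (μ := ν) (f := fun x => w (x, y))
      (.of_forall fun x => hC (x, y))
  have ba : ∀ x, |a x| ≤ C := fun x => by
    simpa using norm_integral_le_of_norm_le_const (μ := ν) (f := fun y => w (x, y))
      (.of_forall fun y => hC (x, y))
  have bβ : ∀ y, |β y| ≤ C' := fun y => by
    simpa using norm_integral_le_of_norm_le_const (μ := ν) (f := fun x => D (x, y))
      (.of_forall fun x => hC' (x, y))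
  have bwb : ∀ p : ℝ × ℝ, |w p - b p.2| ≤ C + C := fun p =>
    (abs_sub _ _).trans (add_le_add (hC p) (bb _))
  have bDβ : ∀ p : ℝ × ℝ, |D p - β p.2| ≤ C' + C' := fun p =>
    (abs_sub _ _).trans (add_le_add (hC' p) (bβ _))
  have i1 : Integrable (fun p : ℝ × ℝ => (w p - b p.2) ^ 2) (ν.prod ν) :=
    integrable_of_measurable_of_bounded (by fun_prop) (exists_abs_sq_le ⟨_, bwb⟩)
  have i2 : Integrable (fun p : ℝ × ℝ => (D p - β p.2) ^ 2) (ν.prod ν) :=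
    integrable_of_measurable_of_bounded (by fun_prop) (exists_abs_sq_le ⟨_, bDβ⟩)
  have ia : Integrable a ν := integrable_of_measurable_of_bounded ma ⟨_, ba⟩
  have ia2 : Integrable (fun x => a x ^ 2) ν :=
    integrable_of_measurable_of_bounded (by fun_prop) (exists_abs_sq_le ⟨_, ba⟩)
  have var : ∫ x, (a x - m) ^ 2 ∂ν = (∫ x, a x ^ 2 ∂ν) - m ^ 2 := by
    rw [integral_sub_const_sq ia ia2, hma]; ring
  have iam : Integrable (fun x => (a x - m) ^ 2) ν := by
    have := (ia2.sub (ia.const_mul (2 * m))).add (integrable_const (m ^ 2))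
    refine this.congr (.of_forall fun x => ?_)
    simp only [Pi.add_apply, Pi.sub_apply]; ring
  have slice_mean : ∀ x, ∫ y, (w (x, y) - b y) ∂ν = a x - m := fun x => by
    rw [integral_sub (integrable_of_measurable_of_bounded
      (Continuous.measurable (by fun_prop)) ⟨C, fun y => hC _⟩)
      (integrable_of_measurable_of_bounded (by fun_prop) ⟨C, bb⟩), hmb]
  have slice : ∀ x, Real.pi ^ 2 * ((∫ y, (w (x, y) - b y) ^ 2 ∂ν) - (a x - m) ^ 2) ≤
      ∫ y, (D (x, y) - β y) ^ 2 ∂ν := fun x => by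
    rw [← slice_mean, hI, hI, hI]
    exact poincare_wirtinger (countable_singleton (1 - x)) (by fun_prop)
      (fun y hy => (hwD x y fun h => hy (by simp; linarith)).sub (hb y)) (by fun_prop)
      ⟨_, fun y => bDβ (x, y)⟩
  have slice_nonneg : ∀ x, 0 ≤ (∫ y, (w (x, y) - b y) ^ 2 ∂ν) - (a x - m) ^ 2 := fun x => by
    have c : Continuous fun y => w (x, y) - b y := by fun_prop
    have i1 : Integrable (fun y => w (x, y) - b y) ν :=
      integrable_of_measurable_of_bounded c.measurable ⟨_, fun y => bwb (x, y)⟩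
    have i2 : Integrable (fun y => (w (x, y) - b y) ^ 2) ν :=
      integrable_of_measurable_of_bounded (c.pow 2).measurable
        (exists_abs_sq_le ⟨_, fun y => bwb (x, y)⟩)
    have : 0 ≤ ∫ y, (w (x, y) - b y - (a x - m)) ^ 2 ∂ν := integral_nonneg fun y => sq_nonneg _
    rw [integral_sub_const_sq i1 i2, slice_mean] at this
    linarith
  have eN : ∫ x, ((∫ y, (w (x, y) - b y) ^ 2 ∂ν) - (a x - m) ^ 2) ∂ν = N := by
    rw [integral_sub i1.integral_prod_left iam, var]
    have := integral_sub_marginal_sq (ν := ν) hw.measurable ⟨C, hC⟩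
    rw [integral_prod _ i1] at this
    rw [this]
    simp only [N]; ring
  refine ⟨eN ▸ integral_nonneg slice_nonneg, ?_⟩
  rw [← eN, ← integral_const_mul, ← integral_sub_marginal_sq hD ⟨C', hC'⟩, integral_prod _ i2]
  exact integral_mono ((i1.integral_prod_left.sub iam).const_mul _) i2.integral_prod_left slice

/-- The unit right isosceles triangle. -/
def unitTriangle : Set (ℝ × ℝ) := {z | 0 ≤ z.1 ∧ 0 ≤ z.2 ∧ z.1 + z.2 ≤ 1}

theorem convexHull_eq_unitTriangle :
    convexHull ℝ {((0 : ℝ), (0 : ℝ)), (1, 0), (0, 1)} = unitTriangle := by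
  apply Subset.antisymm
  · refine convexHull_min ?_ ?_
    · rintro z (rfl | rfl | rfl) <;> simp [unitTriangle]
    · intro z hz w hw s t hs ht hst
      obtain ⟨h1, h2, h3⟩ := hz
      obtain ⟨h4, h5, h6⟩ := hw
      simp only [unitTriangle, mem_ofPred_eq, Prod.fst_add, Prod.smul_fst, Prod.snd_add,
        Prod.smul_snd, smul_eq_mul]
      refine ⟨by positivity, by positivity, ?_⟩
      nlinarith
  · rintro ⟨x, y⟩ ⟨h1, h2, h3⟩
    simp only at h1 h2 h3
    have := (convex_convexHull ℝ {((0 : ℝ), (0 : ℝ)), (1, 0), (0, 1)}).sum_mem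
      (t := Finset.univ) (w := ![1 - x - y, x, y])
      (z := ![((0 : ℝ), (0 : ℝ)), (1, 0), (0, 1)])
      (fun i _ => by fin_cases i <;> simp <;> linarith) (by simp [Fin.sum_univ_three]; ring)
      (fun i _ => subset_convexHull _ _ (by fin_cases i <;> simp))
    simpa [Fin.sum_univ_three] using this

theorem isCompact_unitTriangle : IsCompact unitTriangle := by
  rw [← convexHull_eq_unitTriangle]
  exact (Set.toFinite _).isCompact_convexHull ℝ

/-- The function equal to `p` below the diagonal `x + y = 1` and to the reflection of `q`
above it. -/
noncomputable def glue (p q : ℝ × ℝ → ℝ) (z : ℝ × ℝ) : ℝ :=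
  if z.1 + z.2 ≤ 1 then p z else q (1 - z.2, 1 - z.1)

theorem glue_sq (p q : ℝ × ℝ → ℝ) (z : ℝ × ℝ) :
    glue p q z ^ 2 = glue (fun z => p z ^ 2) (fun z => q z ^ 2) z := by
  unfold glue; split_ifs <;> rfl

theorem measurable_glue {p q : ℝ × ℝ → ℝ} (hp : Continuous p) (hq : Continuous q) :
    Measurable (glue p q) :=
  Measurable.ite (measurableSet_le (by fun_prop) (by fun_prop)) hp.measurable
    (Continuous.measurable (by fun_prop))

theorem exists_abs_glue_le {p q : ℝ × ℝ → ℝ} (hp : ∃ C, ∀ z, |p z| ≤ C)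
    (hq : ∃ C, ∀ z, |q z| ≤ C) :
    ∃ C, ∀ z, |glue p q z| ≤ C := by
  obtain ⟨C, hC⟩ := hp
  obtain ⟨C', hC'⟩ := hq
  refine ⟨max C C', fun z => ?_⟩
  unfold glue
  split_ifs
  · exact (hC _).trans (le_max_left _ _)
  · exact (hC' _).trans (le_max_right _ _)

theorem continuous_glue_self {p : ℝ × ℝ → ℝ} (hp : Continuous p) : Continuous (glue p p) := by
  refine Continuous.if_le hp (by fun_prop) (by fun_prop) (by fun_prop) fun z hz => ?_
  congr 1
  ext <;> simp <;> linarith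

theorem glue_self_reflect (p : ℝ × ℝ → ℝ) (x y : ℝ) :
    glue p p (1 - y, 1 - x) = glue p p (x, y) := by
  unfold glue
  simp only
  split_ifs with h1 h2 h2
  · congr 1
    ext <;> simp <;> linarith
  · rfl
  · simp
  · linarith

theorem ae_off_lines : ∀ᵐ z : ℝ × ℝ, z.1 ≠ 0 ∧ z.2 ≠ 0 ∧ z.1 + z.2 ≠ 1 := by
  have h (c : ℝ) : ∀ᵐ x : ℝ, x ≠ c := by simp [ae_iff]
  have h1 : ∀ᵐ z : ℝ × ℝ, z.1 ≠ 0 := Measure.quasiMeasurePreserving_fst.ae (h 0)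
  have h2 : ∀ᵐ z : ℝ × ℝ, z.2 ≠ 0 := Measure.quasiMeasurePreserving_snd.ae (h 0)
  have h3 : ∀ᵐ z : ℝ × ℝ, z.1 + z.2 ≠ 1 :=
    (Measure.quasiMeasurePreserving_snd.comp
      (measurePreserving_prod_add volume volume).quasiMeasurePreserving).ae (h 1)
  filter_upwards [h1, h2, h3] with z h1 h2 h3 using ⟨h1, h2, h3⟩

theorem measurePreserving_reflect :
    MeasurePreserving (fun z : ℝ × ℝ => (1 - z.2, 1 - z.1)) :=
  ((Measure.measurePreserving_sub_left volume (1 : ℝ)).prod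
    (Measure.measurePreserving_sub_left volume (1 : ℝ))).comp
    Measure.measurePreserving_swap

theorem measurableEmbedding_reflect :
    MeasurableEmbedding (fun z : ℝ × ℝ => (1 - z.2, 1 - z.1)) := by
  refine Continuous.measurableEmbedding (by fun_prop) fun z w h => ?_
  simp only [Prod.mk.injEq] at h
  ext <;> linarith [h.1, h.2]

theorem integral_glue {ν : Measure ℝ} (hν : ν = volume.restrict (Ioc 0 1)) {p q : ℝ × ℝ → ℝ}
    (hp : Continuous p) (hq : Continuous q) (hpb : ∃ C, ∀ z, |p z| ≤ C)
    (hqb : ∃ C, ∀ z, |q z| ≤ C) :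
    ∫ z, glue p q z ∂(ν.prod ν) = (∫ z in unitTriangle, p z) + ∫ z in unitTriangle, q z := by
  set A : Set (ℝ × ℝ) := {z | z.1 + z.2 ≤ 1} with hA
  have mA : MeasurableSet A := measurableSet_le (by fun_prop) (by fun_prop)
  have : IsFiniteMeasure ν := ⟨by simp [hν]⟩
  have i : Integrable (glue p q) (ν.prod ν) :=
    integrable_of_measurable_of_bounded (measurable_glue hp hq) (exists_abs_glue_le hpb hqb)
  rw [← integral_add_compl mA i]
  have hpr : ν.prod ν = volume.restrict (Ioc 0 1 ×ˢ Ioc 0 1) := by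
    rw [hν, Measure.prod_restrict]; rfl
  have mQ : MeasurableSet ((Ioc 0 1 : Set ℝ) ×ˢ (Ioc 0 1 : Set ℝ)) :=
    measurableSet_Ioc.prod measurableSet_Ioc
  rw [hpr, Measure.restrict_restrict mA, Measure.restrict_restrict mA.compl,
    setIntegral_congr_fun (f := glue p q) (mA.inter mQ) (g := p) (fun z hz => if_pos hz.1),
    setIntegral_congr_fun (f := glue p q) (mA.compl.inter mQ) (g := fun z => q (1 - z.2, 1 - z.1))
      (fun z hz => if_neg hz.1),
    ← measurePreserving_reflect.setIntegral_preimage_emb measurableEmbedding_reflect q]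
  congr 1
  · apply setIntegral_congr_set
    filter_upwards [ae_off_lines] with z ⟨h1, h2, h3⟩
    refine propext ⟨fun h => ?_, fun h => ?_⟩
    · obtain ⟨h4, ⟨h5, h6⟩, h7, h8⟩ := h
      exact ⟨h5.le, h7.le, h4⟩
    · obtain ⟨h4, h5, h6⟩ := h
      exact ⟨h6, ⟨lt_of_le_of_ne h4 h1.symm, by linarith⟩, lt_of_le_of_ne h5 h2.symm, by linarith⟩
  · apply setIntegral_congr_set
    filter_upwards [ae_off_lines] with z ⟨h1, h2, h3⟩
    refine propext ⟨fun h => ?_, fun h => ?_⟩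
    · obtain ⟨h4, ⟨h5, h6⟩, h7, h8⟩ := h
      have h4 : ¬ (z.1 + z.2 ≤ 1) := h4
      refine ⟨?_, ?_, ?_⟩ <;> simp only <;> linarith
    · obtain ⟨h4, h5, h6⟩ := h
      simp only at h4 h5 h6
      refine ⟨fun h => h3 (le_antisymm h (by linarith)), ⟨lt_of_le_of_ne ?_ h1.symm, ?_⟩,
        lt_of_le_of_ne ?_ h2.symm, ?_⟩ <;> linarith

theorem hasDerivAt_slice_snd {u : ℝ × ℝ → ℝ} (hu : ContDiff ℝ 1 u) (x y : ℝ) :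
    HasDerivAt (fun t => u (x, t)) (fderiv ℝ u (x, y) (0, 1)) y := by
  have h := (hu.differentiable one_ne_zero (x, y)).hasFDerivAt
  exact h.comp_hasDerivAt y ((hasDerivAt_const y x).prodMk (hasDerivAt_id y))

theorem hasDerivAt_slice_reflect {u : ℝ × ℝ → ℝ} (hu : ContDiff ℝ 1 u) (x y : ℝ) :
    HasDerivAt (fun t => u (1 - t, 1 - x)) (-fderiv ℝ u (1 - y, 1 - x) (1, 0)) y := by
  have h := (hu.differentiable one_ne_zero (1 - y, 1 - x)).hasFDerivAt
  have := h.comp_hasDerivAt y (((hasDerivAt_id y).const_sub 1).prodMk (hasDerivAt_const y (1 - x)))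
  refine this.congr_deriv ?_
  rw [← map_neg]; simp

theorem hasDerivAt_glue {u : ℝ × ℝ → ℝ} (hu : ContDiff ℝ 1 u) (x y : ℝ) (h : x + y ≠ 1) :
    HasDerivAt (fun t => glue u u (x, t))
      (glue (fun z => fderiv ℝ u z (0, 1)) (fun z => -fderiv ℝ u z (1, 0)) (x, y)) y := by
  rcases lt_or_gt_of_ne h with h | h
  · have e : (fun t => glue u u (x, t)) =ᶠ[nhds y] fun t => u (x, t) := by
      filter_upwards [Iio_mem_nhds (show y < 1 - x by linarith)] with t ht
      have ht : t < 1 - x := ht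
      exact if_pos (by simp only; linarith)
    refine ((hasDerivAt_slice_snd hu x y).congr_of_eventuallyEq e).congr_deriv ?_
    exact (if_pos h.le).symm
  · have e : (fun t => glue u u (x, t)) =ᶠ[nhds y] fun t => u (1 - t, 1 - x) := by
      filter_upwards [Ioi_mem_nhds (show 1 - x < y by linarith)] with t ht
      have ht : 1 - x < t := ht
      exact if_neg (by simp only; linarith)
    refine ((hasDerivAt_slice_reflect hu x y).congr_of_eventuallyEq e).congr_deriv ?_
    exact (if_neg h.not_ge).symm

theorem exists_abs_le_of_hasCompactSupport {u : ℝ × ℝ → ℝ} (hu : Continuous u)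
    (hs : HasCompactSupport u) : ∃ C, ∀ z, |u z| ≤ C := hs.exists_bound_of_continuous hu

theorem continuous_partial {u : ℝ × ℝ → ℝ} (hu : ContDiff ℝ 1 u) (e : ℝ × ℝ) :
    Continuous fun z => fderiv ℝ u z e :=
  (hu.continuous_fderiv one_ne_zero).clm_apply continuous_const

theorem hasCompactSupport_partial {u : ℝ × ℝ → ℝ} (hs : HasCompactSupport u) (e : ℝ × ℝ) :
    HasCompactSupport fun z => fderiv ℝ u z e := hs.fderiv_apply ℝ e

theorem exists_abs_partial_le {u : ℝ × ℝ → ℝ} (hu : ContDiff ℝ 1 u) (hs : HasCompactSupport u)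
    (e : ℝ × ℝ) : ∃ C, ∀ z, |fderiv ℝ u z e| ≤ C :=
  exists_abs_le_of_hasCompactSupport (continuous_partial hu e) (hasCompactSupport_partial hs e)

/-- The one-dimensional reduction: `b` is the mean over horizontal lines of the even reflection of
`u` to the unit square. -/
theorem exists_marginal {u : ℝ × ℝ → ℝ} (hu : ContDiff ℝ 1 u) (hs : HasCompactSupport u) :
    ∃ b β : ℝ → ℝ, (∀ y, HasDerivAt b (β y) y) ∧ Measurable β ∧ (∃ C, ∀ y, |β y| ≤ C) ∧
      b 0 = ∫ t in (0 : ℝ)..1, u (t, 0) ∧ b 1 = ∫ t in (0 : ℝ)..1, u (0, t) ∧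
      ∫ y in (0 : ℝ)..1, b y = 2 * ∫ z in unitTriangle, u z ∧
      0 ≤ 2 * (∫ z in unitTriangle, u z ^ 2) - 2 * (∫ y in (0 : ℝ)..1, b y ^ 2)
        + (∫ y in (0 : ℝ)..1, b y) ^ 2 ∧
      Real.pi ^ 2 * (2 * (∫ z in unitTriangle, u z ^ 2) - 2 * (∫ y in (0 : ℝ)..1, b y ^ 2)
        + (∫ y in (0 : ℝ)..1, b y) ^ 2) ≤
        (∫ z in unitTriangle, (fderiv ℝ u z (1, 0) ^ 2 + fderiv ℝ u z (0, 1) ^ 2))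
          - ∫ y in (0 : ℝ)..1, β y ^ 2 := by
  set D := glue (fun z => fderiv ℝ u z (0, 1)) (fun z => -fderiv ℝ u z (1, 0)) with hDdef
  set w := glue u u with hwdef
  have hw : Continuous w := continuous_glue_self hu.continuous
  have ub := exists_abs_le_of_hasCompactSupport hu.continuous hs
  have hwb : ∃ C, ∀ p, |w p| ≤ C := exists_abs_glue_le ub ub
  have c0 := continuous_partial hu (1, 0)
  have c1 := continuous_partial hu (0, 1)
  have b0 := exists_abs_partial_le hu hs (1, 0)
  have b1 := exists_abs_partial_le hu hs (0, 1)
  have hD : Measurable D := measurable_glue c1 c0.neg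
  have hDb : ∃ C, ∀ p, |D p| ≤ C := exists_abs_glue_le b1 (by simpa only [abs_neg] using b0)
  obtain ⟨ν, hν⟩ : ∃ ν : Measure ℝ, ν = volume.restrict (Ioc 0 1) := ⟨_, rfl⟩
  have : IsProbabilityMeasure ν := ⟨by simp [hν]⟩
  have hI : ∀ f : ℝ → ℝ, ∫ x, f x ∂ν = ∫ x in (0 : ℝ)..1, f x := fun f => by
    rw [hν, intervalIntegral.integral_of_le zero_le_one]
  have key := poincare_square hν hw hwb hD hDb (hasDerivAt_glue hu)
  have iw2 : ∫ p, w p ^ 2 ∂(ν.prod ν) = 2 * ∫ z in unitTriangle, u z ^ 2 := by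
    simp only [hwdef, glue_sq]
    rw [integral_glue (p := fun z => u z ^ 2) (q := fun z => u z ^ 2) hν (hu.continuous.pow 2)
      (hu.continuous.pow 2) (exists_abs_sq_le ub) (exists_abs_sq_le ub)]
    ring
  have iw : ∫ p, w p ∂(ν.prod ν) = 2 * ∫ z in unitTriangle, u z := by
    rw [integral_glue hν hu.continuous hu.continuous ub ub]; ring
  have iD2 : ∫ p, D p ^ 2 ∂(ν.prod ν) =
      ∫ z in unitTriangle, (fderiv ℝ u z (1, 0) ^ 2 + fderiv ℝ u z (0, 1) ^ 2) := by
    simp only [hDdef, glue_sq, neg_sq]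
    rw [integral_glue (p := fun z => fderiv ℝ u z (0, 1) ^ 2)
        (q := fun z => fderiv ℝ u z (1, 0) ^ 2) hν (c1.pow 2) (c0.pow 2) (exists_abs_sq_le b1)
        (exists_abs_sq_le b0),
      integral_add (f := fun z => fderiv ℝ u z (1, 0) ^ 2) (g := fun z => fderiv ℝ u z (0, 1) ^ 2)
        ((c0.pow 2).continuousOn.integrableOn_compact isCompact_unitTriangle)
        ((c1.pow 2).continuousOn.integrableOn_compact isCompact_unitTriangle), add_comm]
  have hmb : ∫ y in (0 : ℝ)..1, (∫ x in (0 : ℝ)..1, w (x, y)) = 2 * ∫ z in unitTriangle, u z := by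
    simp only [← hI]
    rw [← iw, integral_prod_symm w (integrable_of_measurable_of_bounded hw.measurable hwb)]
  have hsym : ∀ x, ∫ y in (0 : ℝ)..1, w (x, y) = ∫ t in (0 : ℝ)..1, w (t, 1 - x) := fun x => by
    have := intervalIntegral.integral_comp_sub_left (a := 0) (b := 1) (fun t => w (t, 1 - x)) 1
    rw [sub_self, sub_zero] at this
    rw [← this]
    simp only [hwdef, glue_self_reflect]
  have hab : ∫ x in (0 : ℝ)..1, (∫ y in (0 : ℝ)..1, w (x, y)) ^ 2 =
      ∫ y in (0 : ℝ)..1, (∫ x in (0 : ℝ)..1, w (x, y)) ^ 2 := by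
    simp only [hsym]
    rw [intervalIntegral.integral_comp_sub_left
      (fun y => (∫ t in (0 : ℝ)..1, w (t, y)) ^ 2) 1, sub_self, sub_zero]
  obtain ⟨C, hC⟩ := hDb
  refine ⟨fun y => ∫ x in (0 : ℝ)..1, w (x, y), fun y => ∫ x in (0 : ℝ)..1, D (x, y),
    hasDerivAt_integral_of_kinks hw hD ⟨C, hC⟩ (hasDerivAt_glue hu), ?_, ⟨C, fun y => ?_⟩,
    ?_, ?_, hmb, ?_⟩
  · simp only [← hI]
    exact (hD.stronglyMeasurable.integral_prod_left' (μ := ν)).measurable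
  · simp only [← hI]
    simpa using norm_integral_le_of_norm_le_const (μ := ν) (f := fun x => D (x, y))
      (.of_forall fun x => hC (x, y))
  · refine intervalIntegral.integral_congr fun x hx => if_pos ?_
    rw [uIcc_of_le zero_le_one] at hx
    simpa using hx.2
  · have h := hsym 0
    rw [sub_zero] at h
    refine h.symm.trans ?_
    refine intervalIntegral.integral_congr fun x hx => if_pos ?_
    rw [uIcc_of_le zero_le_one] at hx
    simpa using hx.2
  · simp only [hI, iw2, iw, iD2, hab] at key
    rw [hmb]
    refine ⟨by linarith [key.1], ?_⟩
    convert key.2 using 2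
    ring

/-- The Poincaré inequality on the unit triangle. -/
theorem poincare_unitTriangle {u : ℝ × ℝ → ℝ} (hu : ContDiff ℝ 1 u) (hs : HasCompactSupport u)
    (h0 : ∫ z in unitTriangle, u z = 0) :
    Real.pi ^ 2 * (∫ z in unitTriangle, u z ^ 2) ≤
      ∫ z in unitTriangle, (fderiv ℝ u z (1, 0) ^ 2 + fderiv ℝ u z (0, 1) ^ 2) := by
  obtain ⟨b, β, hb, mβ, bβ, -, -, hm, hN, hle⟩ := exists_marginal hu hs
  have hc : Continuous b := continuous_iff_continuousAt.2 fun x => (hb x).continuousAt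
  have := poincare_wirtinger countable_empty hc (fun x _ => hb x) mβ bβ
  rw [hm, h0] at *
  nlinarith [sq_nonneg Real.pi]

/-- The Poincaré inequality for functions with vanishing mean on both legs of the triangle. -/
theorem poincare_unitTriangle_legs {u : ℝ × ℝ → ℝ} (hu : ContDiff ℝ 1 u)
    (hs : HasCompactSupport u) (h1 : ∫ t in (0 : ℝ)..1, u (t, 0) = 0)
    (h2 : ∫ t in (0 : ℝ)..1, u (0, t) = 0) :
    ∫ z in unitTriangle, u z ^ 2 ≤
      0.24647 ^ 2 * ∫ z in unitTriangle, (fderiv ℝ u z (1, 0) ^ 2 + fderiv ℝ u z (0, 1) ^ 2) := by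
  obtain ⟨b, β, hb, mβ, bβ, e0, e1, hm, hN, hle⟩ := exists_marginal hu hs
  have := sq_deriv_bound_of_zero_endpoints hb mβ bβ (e0.trans h1) (e1.trans h2)
  have hpi : (1 / 0.24647) ^ 2 / 2 ≤ Real.pi ^ 2 := by
    have := Real.pi_gt_three
    norm_num
    nlinarith
  have := mul_le_mul_of_nonneg_right hpi hN
  norm_num at *
  linarith

theorem integral_partial_snd {u : ℝ × ℝ → ℝ} (hu : ContDiff ℝ 1 u) (hs : HasCompactSupport u) :
    ∫ z in unitTriangle, fderiv ℝ u z (0, 1) =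
      (∫ t in (0 : ℝ)..1, u (t, 1 - t)) - ∫ t in (0 : ℝ)..1, u (t, 0) := by
  have c1 := continuous_partial hu (0, 1)
  have b1 := exists_abs_partial_le hu hs (0, 1)
  obtain ⟨ν, hν⟩ : ∃ ν : Measure ℝ, ν = volume.restrict (Ioc 0 1) := ⟨_, rfl⟩
  have : IsProbabilityMeasure ν := ⟨by simp [hν]⟩
  have hI : ∀ f : ℝ → ℝ, ∫ x, f x ∂ν = ∫ x in (0 : ℝ)..1, f x := fun f => by
    rw [hν, intervalIntegral.integral_of_le zero_le_one]
  set D := glue (fun z => fderiv ℝ u z (0, 1)) (fun _ => 0) with hD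
  have mD : Measurable D := measurable_glue c1 continuous_const
  have bD : ∃ C, ∀ z, |D z| ≤ C := exists_abs_glue_le b1 ⟨0, by simp⟩
  have e := integral_glue hν c1 continuous_const b1 (q := fun _ => 0) ⟨0, by simp⟩
  rw [integral_zero, add_zero, integral_prod _ (integrable_of_measurable_of_bounded mD bD)] at e
  have cu := hu.continuous
  rw [← e, hI, ← intervalIntegral.integral_sub (Continuous.intervalIntegrable (by fun_prop) _ _)
    (Continuous.intervalIntegrable (by fun_prop) _ _)]
  refine intervalIntegral.integral_congr fun x hx => ?_
  rw [uIcc_of_le zero_le_one] at hx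
  simp only [hI]
  rw [MeasureTheory.integral_eq_of_hasDerivAt_off_countable (fun y => u (x, min y (1 - x))) _
    (countable_singleton (1 - x)) (Continuous.continuousOn (by fun_prop)) (fun y hy => ?_)
    (intervalIntegrable_of_measurable_of_bounded (by fun_prop)
      (bD.imp fun C hC y => hC (x, y)) _ _)]
  · rw [min_eq_right (by linarith [hx.1]), min_eq_left (by linarith [hx.2])]
  · rcases lt_or_gt_of_ne (show y ≠ 1 - x from hy.2) with h | h
    · have e : (fun t => u (x, min t (1 - x))) =ᶠ[nhds y] fun t => u (x, t) := by
        filter_upwards [Iio_mem_nhds h] with t ht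
        rw [min_eq_left (le_of_lt ht)]
      refine ((hasDerivAt_slice_snd hu x y).congr_of_eventuallyEq e).congr_deriv ?_
      exact (if_pos (by simp only; linarith)).symm
    · have e : (fun t => u (x, min t (1 - x))) =ᶠ[nhds y] fun t => u (x, 1 - x) := by
        filter_upwards [Ioi_mem_nhds h] with t ht
        rw [min_eq_right (le_of_lt ht)]
      refine ((hasDerivAt_const y _).congr_of_eventuallyEq e).congr_deriv ?_
      exact (if_neg (by simp only; linarith)).symm

theorem integral_partial_fst {u : ℝ × ℝ → ℝ} (hu : ContDiff ℝ 1 u) (hs : HasCompactSupport u) :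
    ∫ z in unitTriangle, fderiv ℝ u z (1, 0) =
      (∫ t in (0 : ℝ)..1, u (t, 1 - t)) - ∫ t in (0 : ℝ)..1, u (0, t) := by
  have hv : ContDiff ℝ 1 fun z : ℝ × ℝ => u (z.2, z.1) :=
    hu.comp (contDiff_snd.prodMk contDiff_fst)
  have hvs : HasCompactSupport fun z : ℝ × ℝ => u (z.2, z.1) :=
    hs.comp_homeomorph (Homeomorph.prodComm ℝ ℝ)
  have hd (z : ℝ × ℝ) : fderiv ℝ u (z.2, z.1) (1, 0) =
      fderiv ℝ (fun z : ℝ × ℝ => u (z.2, z.1)) z (0, 1) := by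
    have h : HasFDerivAt (fun z : ℝ × ℝ => u (z.2, z.1)) _ z :=
      HasFDerivAt.comp z (hu.differentiable one_ne_zero (z.2, z.1)).hasFDerivAt
        ((hasFDerivAt_snd (𝕜 := ℝ) (p := z)).prodMk (hasFDerivAt_fst (𝕜 := ℝ) (p := z)))
    exact (DFunLike.congr_fun h.fderiv (0, 1)).symm
  have hT : Prod.swap ⁻¹' unitTriangle = unitTriangle := by
    ext z
    constructor <;> rintro ⟨h1, h2, h3⟩ <;> exact ⟨h2, h1, by rw [add_comm]; exact h3⟩
  have hr := intervalIntegral.integral_comp_sub_left (a := 0) (b := 1) (fun t => u (t, 1 - t)) 1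
  rw [sub_self, sub_zero] at hr
  have hswap := (Measure.measurePreserving_swap (μ := (volume : Measure ℝ))
    (ν := (volume : Measure ℝ))).setIntegral_preimage_emb
    MeasurableEquiv.prodComm.measurableEmbedding (fun z => fderiv ℝ u z (1, 0)) unitTriangle
  rw [hT] at hswap
  rw [← hr]
  refine hswap.symm.trans ?_
  refine (integral_congr_ae (.of_forall hd)).trans ((integral_partial_snd hv hvs).trans ?_)
  simp only [sub_sub_cancel]

theorem interpolation_bound_of_contDiff {u : ℝ × ℝ → ℝ} (hu : ContDiff ℝ 2 u)
    (hs : HasCompactSupport u) (h1 : ∫ t in (0 : ℝ)..1, u (t, 0) = 0)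
    (h2 : ∫ t in (0 : ℝ)..1, u (0, t) = 0) (h3 : ∫ t in (0 : ℝ)..1, u (t, 1 - t) = 0) :
    ∫ x in unitTriangle, u x ^ 2 ≤ (0.24647 / Real.pi) ^ 2 *
      ∫ x in unitTriangle, ((fderiv ℝ (fun y => fderiv ℝ u y (1, 0)) x (1, 0)) ^ 2 +
        2 * (fderiv ℝ (fun y => fderiv ℝ u y (1, 0)) x (0, 1)) ^ 2 +
        (fderiv ℝ (fun y => fderiv ℝ u y (0, 1)) x (0, 1)) ^ 2) := by
  have hu1 : ContDiff ℝ 1 u := hu.of_le one_le_two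
  have hd (e : ℝ × ℝ) : ContDiff ℝ 1 fun z => fderiv ℝ u z e :=
    (hu.fderiv_right (m := 1) (by norm_num)).clm_apply contDiff_const
  have hds (e : ℝ × ℝ) := hasCompactSupport_partial hs e
  have hsymm (x : ℝ × ℝ) : fderiv ℝ (fun y => fderiv ℝ u y (0, 1)) x (1, 0) =
      fderiv ℝ (fun y => fderiv ℝ u y (1, 0)) x (0, 1) := by
    have hdiff : DifferentiableAt ℝ (fderiv ℝ u) x :=
      (hu.fderiv_right (m := 1) (by norm_num)).differentiable one_ne_zero x
    rw [fderiv_clm_apply hdiff (by fun_prop), fderiv_clm_apply hdiff (by fun_prop)]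
    simpa using (hu.contDiffAt.isSymmSndFDerivAt (by simp)).eq (1, 0) (0, 1)
  have main := poincare_unitTriangle_legs hu1 hs h1 h2
  have p1 := poincare_unitTriangle (hd (1, 0)) (hds (1, 0))
    (by rw [integral_partial_fst hu1 hs, h2, h3, sub_zero])
  have p2 := poincare_unitTriangle (hd (0, 1)) (hds (0, 1))
    (by rw [integral_partial_snd hu1 hs, h1, h3, sub_zero])
  have int {f : ℝ × ℝ → ℝ} (hf : Continuous f) : IntegrableOn f unitTriangle :=
    hf.continuousOn.integrableOn_compact isCompact_unitTriangle
  have c (e e' : ℝ × ℝ) := continuous_partial (hd e) e'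
  rw [integral_add (f := fun z => fderiv ℝ u z (1, 0) ^ 2)
    (g := fun z => fderiv ℝ u z (0, 1) ^ 2) (int ((hd _).continuous.pow 2))
    (int ((hd _).continuous.pow 2))] at main
  have e : ∫ x in unitTriangle, ((fderiv ℝ (fun y => fderiv ℝ u y (1, 0)) x (1, 0)) ^ 2 +
        2 * (fderiv ℝ (fun y => fderiv ℝ u y (1, 0)) x (0, 1)) ^ 2 +
        (fderiv ℝ (fun y => fderiv ℝ u y (0, 1)) x (0, 1)) ^ 2) =
      (∫ z in unitTriangle, (fderiv ℝ (fun y => fderiv ℝ u y (1, 0)) z (1, 0) ^ 2 +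
        fderiv ℝ (fun y => fderiv ℝ u y (1, 0)) z (0, 1) ^ 2)) +
      ∫ z in unitTriangle, (fderiv ℝ (fun y => fderiv ℝ u y (0, 1)) z (1, 0) ^ 2 +
        fderiv ℝ (fun y => fderiv ℝ u y (0, 1)) z (0, 1) ^ 2) := by
    refine Eq.trans ?_ (integral_add (int (((c _ _).pow 2).add ((c _ _).pow 2)))
      (int (((c _ _).pow 2).add ((c _ _).pow 2))))
    refine integral_congr_ae (.of_forall fun x => ?_)
    simp only [hsymm]
    ring
  rw [e, div_pow, div_mul_eq_mul_div, le_div_iff₀ (by positivity)]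
  nlinarith

open scoped Manifold ContDiff in
theorem exists_cutoff {T U : Set (ℝ × ℝ)} (hT : IsCompact T) (hU : IsOpen U) (hTU : T ⊆ U)
    {v : ℝ × ℝ → ℝ} (hv : ContDiffOn ℝ 2 v U) :
    ∃ u : ℝ × ℝ → ℝ, ContDiff ℝ 2 u ∧ HasCompactSupport u ∧ ∀ x ∈ T, u =ᶠ[nhds x] v := by
  obtain ⟨K, hK, hTK, hKU⟩ := exists_compact_between hT hU hTU
  obtain ⟨f, hf1, hf0, -⟩ := exists_contMDiffMap_one_nhds_of_subset_interior (n := (2 : ℕ∞))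
    𝓘(ℝ, ℝ × ℝ) hT.isClosed hTK
  have hf : ContDiff ℝ 2 f := f.contMDiff.contDiff
  refine ⟨fun x => f x * v x, ?_, ?_, fun x hx => ?_⟩
  · refine contDiff_iff_contDiffAt.2 fun x => ?_
    by_cases hx : x ∈ U
    · exact hf.contDiffAt.mul (hv.contDiffAt (hU.mem_nhds hx))
    · have : (fun x => f x * v x) =ᶠ[nhds x] fun _ => 0 := by
        filter_upwards [hK.isClosed.isOpen_compl.mem_nhds fun h => hx (hKU h)] with y hy
        rw [hf0 y hy, zero_mul]
      exact contDiffAt_const.congr_of_eventuallyEq this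
  · exact HasCompactSupport.intro hK fun x hx => by rw [hf0 x hx, zero_mul]
  · filter_upwards [(eventually_nhdsSet_iff_forall.1 hf1) x hx] with y hy
    rw [hy, one_mul]

/-- On the unit right isosceles triangle `T`, every `v` that is `C²` on a neighborhood
of `T` with vanishing mean on all three edges satisfies
`‖v‖² ≤ (0.24647/π)² · |v|₂²`. -/
theorem stmt_8
    (T : Set (ℝ × ℝ))
    (hT : T = convexHull ℝ {((0 : ℝ), (0 : ℝ)), (1, 0), (0, 1)})
    (v : ℝ × ℝ → ℝ)
    (hv : ∃ U : Set (ℝ × ℝ), IsOpen U ∧ T ⊆ U ∧ ContDiffOn ℝ 2 v U)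
    (he1 : ∫ t in (0:ℝ)..1, v (t, 0) = 0)
    (he2 : ∫ t in (0:ℝ)..1, v (0, t) = 0)
    (he3 : ∫ t in (0:ℝ)..1, v (t, 1 - t) = 0) :
    ∫ x in T, (v x) ^ 2 ≤
      ((0.24647 : ℝ) / Real.pi) ^ 2 *
        ∫ x in T,
          ((fderiv ℝ (fun y => fderiv ℝ v y (1, 0)) x (1, 0)) ^ 2 +
            2 * (fderiv ℝ (fun y => fderiv ℝ v y (1, 0)) x (0, 1)) ^ 2 +
            (fderiv ℝ (fun y => fderiv ℝ v y (0, 1)) x (0, 1)) ^ 2) := by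
  rw [convexHull_eq_unitTriangle] at hT
  subst hT
  obtain ⟨U, hU, hTU, hv⟩ := hv
  obtain ⟨u, hu, hs, huv⟩ := exists_cutoff isCompact_unitTriangle hU hTU hv
  have hT := isCompact_unitTriangle.measurableSet
  have h2 (e e' : ℝ × ℝ) : ∀ x ∈ unitTriangle, fderiv ℝ (fun y => fderiv ℝ u y e) x e' =
      fderiv ℝ (fun y => fderiv ℝ v y e) x e' := fun x hx => by
    have : (fun y => fderiv ℝ u y e) =ᶠ[nhds x] fun y => fderiv ℝ v y e :=
      ((huv x hx).fderiv (𝕜 := ℝ)).mono fun y hy => by simp only [hy]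
    rw [this.fderiv_eq]
  have edge (γ : ℝ → ℝ × ℝ) (hγ : ∀ t ∈ Icc (0 : ℝ) 1, γ t ∈ unitTriangle) :
      ∫ t in (0 : ℝ)..1, u (γ t) = ∫ t in (0 : ℝ)..1, v (γ t) :=
    intervalIntegral.integral_congr fun t ht => by
      rw [uIcc_of_le zero_le_one] at ht
      exact (huv _ (hγ t ht)).eq_of_nhds
  have main := interpolation_bound_of_contDiff hu hs
    ((edge (fun t => (t, 0)) fun t ht => ⟨ht.1, le_rfl, by simpa using ht.2⟩).trans he1)
    ((edge (fun t => (0, t)) fun t ht => ⟨le_rfl, ht.1, by simpa using ht.2⟩).trans he2)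
    ((edge (fun t => (t, 1 - t)) fun t ht => ⟨ht.1, by simpa using ht.2, by simp⟩).trans he3)
  rw [setIntegral_congr_fun hT (g := fun x => v x ^ 2) fun x hx => by
      simp only [(huv x hx).eq_of_nhds]] at main
  refine main.trans_eq ?_
  congr 1
  exact setIntegral_congr_fun hT fun x hx => by simp only [h2 _ _ x hx]
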